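/- Let N ≥ 1 and let Ω be the standard symplectic form on ℝ^{2N}. Let V_σ be a real symmetric 2N×2N matrix such that V_σ is positive definite and the complex matrix V_σ + iΩ is positive definite, and let S be a symplectic matrix (SΩSᵀ = Ω). Then SSᵀ belongs to the closure (in the finite-dimensional space of real 2N×2N matrices) of the set { f_σ(W) : W a real symmetric 2N×2N matrix with W + iΩ positive semidefinite as a complex matrix } if and only if V_σ − SSᵀ is positive semidefinite. -/

import Mathlib

open Matrix
open scoped ComplexOrder

noncomputable section

/-- The standard symplectic form on `ℝ^(2N)`: block diagonal with `N` blocks `[[0,1],[-1,0]]`. -/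
def symp (N : ℕ) : Matrix (Fin (2*N)) (Fin (2*N)) ℝ :=
  Matrix.of fun i j =>
    if i.val % 2 = 0 ∧ j.val = i.val + 1 then 1
    else if j.val % 2 = 0 ∧ i.val = j.val + 1 then -1
    else 0

/-- View a real matrix as a complex matrix. -/
def cplx {n : Type*} (M : Matrix n n ℝ) : Matrix n n ℂ :=
  M.map (fun x => (x : ℂ))

/-- `V` is a bona fide quantum covariance matrix w.r.t. the symplectic form `Om`:
the complex matrix `V + i·Om` is positive semidefinite. -/
def BonaFide {n : Type*} [Fintype n] (V Om : Matrix n n ℝ) : Prop :=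
  (cplx V + Complex.I • cplx Om).PosSemidef

/-- The (positive semidefinite) square root of a positive semidefinite real matrix,
via the continuous functional calculus. -/
def msqrt {n : Type*} [Fintype n] [DecidableEq n] (M : Matrix n n ℝ) : Matrix n n ℝ :=
  cfc Real.sqrt M

/-- `X_V = V^{1/2} (I + A⁻²)^{1/2} V^{1/2}` where `A = V^{1/2} Ω V^{1/2}`. -/
def Xmat {n : Type*} [Fintype n] [DecidableEq n] (V Om : Matrix n n ℝ) : Matrix n n ℝ :=
  msqrt V * msqrt (1 + (msqrt V * Om * msqrt V)⁻¹ * (msqrt V * Om * msqrt V)⁻¹) * msqrt V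

section helpers

set_option linter.unusedSectionVars false

lemma symp_transpose (N : ℕ) : (symp N)ᵀ = - symp N := by
  ext i j
  simp only [symp, transpose_apply, of_apply, Matrix.neg_apply]
  split_ifs <;> first | omega | (simp; done) | (exfalso; simp at *; omega)

lemma symp_mul_symp (N : ℕ) : symp N * symp N = -1 := by
  ext i k
  have hi := i.isLt
  by_cases h : i.val % 2 = 0
  · have hlt : i.val + 1 < 2 * N := by omega
    rw [mul_apply, Finset.sum_eq_single (⟨i.val + 1, hlt⟩ : Fin (2*N))]
    · simp only [symp, of_apply, Matrix.neg_apply, Matrix.one_apply, Fin.ext_iff]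
      split_ifs <;> first | omega | (simp; done) | (exfalso; simp at *; omega)
    · intro b _ hb
      simp only [ne_eq, Fin.ext_iff] at hb
      have : symp N i b = 0 := by
        simp only [symp, of_apply]
        split_ifs <;> first | omega | (simp; done) | (exfalso; simp at *; omega)
      rw [this, zero_mul]
    · simp
  · have hlt : i.val - 1 < 2 * N := by omega
    rw [mul_apply, Finset.sum_eq_single (⟨i.val - 1, hlt⟩ : Fin (2*N))]
    · simp only [symp, of_apply, Matrix.neg_apply, Matrix.one_apply, Fin.ext_iff]
      split_ifs <;> first | omega | (simp; done) | (exfalso; simp at *; omega)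
    · intro b _ hb
      simp only [ne_eq, Fin.ext_iff] at hb
      have : symp N i b = 0 := by
        simp only [symp, of_apply]
        split_ifs <;> first | omega | (simp; done) | (exfalso; simp at *; omega)
      rw [this, zero_mul]
    · simp

variable {n : Type*} [Fintype n] [DecidableEq n]

lemma cplx_eq (M : Matrix n n ℝ) : cplx M = Complex.ofRealHom.mapMatrix M := rfl
lemma cplx_mul (M K : Matrix n n ℝ) : cplx (M * K) = cplx M * cplx K := by
  simp only [cplx_eq, map_mul]
lemma cplx_add (M K : Matrix n n ℝ) : cplx (M + K) = cplx M + cplx K := by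
  simp only [cplx_eq, map_add]
lemma cplx_sub (M K : Matrix n n ℝ) : cplx (M - K) = cplx M - cplx K := by
  simp only [cplx_eq, map_sub]
lemma cplx_neg (M : Matrix n n ℝ) : cplx (-M) = -cplx M := by
  simp only [cplx_eq, map_neg]
lemma cplx_one : cplx (1 : Matrix n n ℝ) = 1 := by
  simp only [cplx_eq, map_one]
lemma cplx_smul (t : ℝ) (M : Matrix n n ℝ) : cplx (t • M) = (t : ℂ) • cplx M := by
  ext i j; simp [cplx]
lemma cplx_transpose (M : Matrix n n ℝ) : cplx Mᵀ = (cplx M)ᵀ := rfl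
lemma cplx_conjTranspose (M : Matrix n n ℝ) : (cplx M)ᴴ = cplx Mᵀ := by
  ext i j; simp [cplx]
lemma cplx_inv (M : Matrix n n ℝ) (h : IsUnit M) : cplx M⁻¹ = (cplx M)⁻¹ := by
  symm
  apply Matrix.inv_eq_right_inv
  rw [← cplx_mul, Matrix.mul_nonsing_inv _ ((Matrix.isUnit_iff_isUnit_det _).1 h), cplx_one]
lemma cplx_isUnit (M : Matrix n n ℝ) (h : IsUnit M) : IsUnit (cplx M) := by
  rw [cplx_eq]; exact h.map _

lemma real_psd_of (W K : Matrix n n ℝ) (hW : W.IsSymm)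
    (h : (cplx W + Complex.I • cplx K).PosSemidef) : W.PosSemidef := by
  have hH : W.IsHermitian := by
    rw [IsHermitian, conjTranspose_eq_transpose_of_trivial]; exact hW
  refine PosSemidef.of_dotProduct_mulVec_nonneg hH fun x => ?_
  have h0 := h.re_dotProduct_nonneg (fun i => (x i : ℂ))
  have h1 : RCLike.re (star (fun i => (x i : ℂ)) ⬝ᵥ
      ((cplx W + Complex.I • cplx K) *ᵥ (fun i => (x i : ℂ)))) = star x ⬝ᵥ (W *ᵥ x) := by
    simp [dotProduct, mulVec, cplx, Finset.mul_sum]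
  rw [← h1]; exact h0

lemma cplx_psd (M : Matrix n n ℝ) (h : M.PosSemidef) : (cplx M).PosSemidef := by
  obtain ⟨m, v, rfl⟩ := Matrix.posSemidef_iff_eq_sum_vecMulVec.1 h
  rw [cplx_eq, map_sum]
  refine posSemidef_sum _ fun i _ => ?_
  convert posSemidef_vecMulVec_self_star (fun j => (v i j : ℂ)) using 1
  ext j k; simp [vecMulVec]

lemma cplx_pd (M : Matrix n n ℝ) (h : M.PosDef) : (cplx M).PosDef :=
  (cplx_psd M h.posSemidef).posDef_iff_isUnit.2 (cplx_isUnit M h.isUnit)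

lemma msqrt_mul_self (M : Matrix n n ℝ) (h : M.PosSemidef) : msqrt M * msqrt M = M := by
  have hsa : IsSelfAdjoint M := h.1
  unfold msqrt
  rw [← cfc_mul (R := ℝ) Real.sqrt Real.sqrt M]
  conv_rhs => rw [← cfc_id ℝ M]
  apply cfc_congr
  intro x hx
  have := (posSemidef_iff_isHermitian_and_spectrum_nonneg.1 h).2 hx
  simpa using Real.mul_self_sqrt this

lemma msqrt_symm (M : Matrix n n ℝ) : (msqrt M)ᵀ = msqrt M := by
  have : IsSelfAdjoint (msqrt M) := cfc_predicate (R := ℝ) Real.sqrt M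
  simpa [IsSelfAdjoint, star_eq_conjTranspose] using this

lemma isUnit_of_mul_self {M K : Matrix n n ℝ} (h : M * M = K) (hK : IsUnit K) : IsUnit M := by
  subst h
  rw [Matrix.isUnit_iff_isUnit_det, det_mul] at hK
  rw [Matrix.isUnit_iff_isUnit_det]
  exact isUnit_of_mul_isUnit_left hK

lemma inv_anti {T D : Matrix n n ℂ} (hT : T.PosDef) (hD : D.PosDef) (h : (T - D).PosSemidef) :
    (D⁻¹ - T⁻¹).PosSemidef := by
  have := hT.isUnit.invertible
  have := hD.isUnit.invertible
  have := hD.inv.isUnit.invertible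
  have h1 := PosDef.fromBlocks₁₁ (A := T) (1 : Matrix n n ℂ) D⁻¹ hT
  have h2 := PosDef.fromBlocks₂₂ T (1 : Matrix n n ℂ) hD.inv
  have h3 := h1.symm.trans h2
  simp only [conjTranspose_one, one_mul, mul_one] at h3
  rw [h3, Matrix.inv_inv_of_invertible]
  exact h

end helpers
section main
variable {n : Type*} [Fintype n] [DecidableEq n]

/-- Abstract square-root data for `X`. -/
lemma X_data (V Om : Matrix n n ℝ) (hVpd : V.PosDef) (hT : Omᵀ = -Om) (hO : Om * Om = -1)
    (hC : (cplx V + Complex.I • cplx Om).PosDef) :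
    ∃ R B C : Matrix n n ℝ, R * R = V ∧ Rᵀ = R ∧ IsUnit R ∧ Bᵀ = B ∧ IsUnit B ∧
      B * B = 1 + C * C ∧ B * C = C * B ∧ R * C * R = -Om ∧ Xmat V Om = R * B * R := by
  have hR2 := msqrt_mul_self V hVpd.posSemidef
  have hRs := msqrt_symm V
  have hRu : IsUnit (msqrt V) := isUnit_of_mul_self hR2 hVpd.isUnit
  have hRd := (Matrix.isUnit_iff_isUnit_det _).1 hRu
  unfold Xmat
  set R := msqrt V with hR
  set C := (R * Om * R)⁻¹ with hCdef
  have hOi : Om⁻¹ = -Om := Matrix.inv_eq_right_inv (by rw [mul_neg, hO, neg_neg])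
  have hRCR : R * C * R = -Om := by
    rw [hCdef, Matrix.mul_inv_rev, Matrix.mul_inv_rev, hOi]
    calc R * (R⁻¹ * (-Om * R⁻¹)) * R = (R * R⁻¹) * (-Om) * (R⁻¹ * R) := by noncomm_ring
      _ = -Om := by
        rw [Matrix.mul_nonsing_inv _ hRd, Matrix.nonsing_inv_mul _ hRd, one_mul, mul_one]
  have hCT : Cᵀ = -C := by
    have e : R * Cᵀ * R = R * (-C) * R := by
      have := congrArg transpose hRCR
      rw [transpose_mul, transpose_mul, hRs, transpose_neg, hT] at this
      rw [mul_neg, neg_mul, hRCR, ← mul_assoc] at *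
      exact this
    exact hRu.mul_left_cancel (hRu.mul_right_cancel e)
  -- complex
  have hRcu := cplx_isUnit R hRu
  have hRcs : (cplx R)ᴴ = cplx R := by rw [cplx_conjTranspose, hRs]
  have hfac : cplx V + Complex.I • cplx Om
      = cplx R * (1 - Complex.I • cplx C) * star (cplx R) := by
    rw [star_eq_conjTranspose, hRcs, mul_sub, sub_mul, mul_one, ← cplx_mul, hR2,
      mul_smul_comm, smul_mul_assoc, ← cplx_mul, ← cplx_mul, hRCR, cplx_neg, smul_neg,
      sub_neg_eq_add]
  have hm : (1 - Complex.I • cplx C).PosDef := by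
    rw [hfac] at hC
    exact (Matrix.IsUnit.posDef_star_right_conjugate_iff hRcu).1 hC
  have hp : (1 + Complex.I • cplx C).PosDef := by
    have := hm.transpose
    rw [transpose_sub, transpose_one, transpose_smul, ← cplx_transpose, hCT, cplx_neg, smul_neg,
      sub_neg_eq_add] at this
    exact this
  have hprod : cplx (1 + C * C) = (1 - Complex.I • cplx C) * (1 + Complex.I • cplx C) := by
    rw [cplx_add, cplx_one, cplx_mul, mul_add, sub_mul, sub_mul]
    simp only [mul_one, one_mul, mul_smul_comm, smul_mul_assoc, smul_smul, Complex.I_mul_I,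
      neg_smul, one_smul]
    abel
  have hpsdC : (cplx (1 + C * C)).PosSemidef := by
    have e1 := hp.posSemidef.conjTranspose_mul_mul_same (1 - Complex.I • cplx C)
    have e2 := hm.posSemidef.conjTranspose_mul_mul_same (1 + Complex.I • cplx C)
    rw [hm.1.eq] at e1
    rw [hp.1.eq] at e2
    have e3 := (e1.add e2).smul (a := (2⁻¹ : ℝ)) (by norm_num)
    convert e3 using 1
    rw [hprod]
    generalize Complex.I • cplx C = Y
    have : (1 - Y) * (1 + Y) * (1 - Y) + (1 + Y) * (1 - Y) * (1 + Y)
      = (2 : ℝ) • ((1 - Y) * (1 + Y)) := by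
      rw [two_smul]; noncomm_ring
    rw [this, smul_smul]; norm_num
  have hsymm : (1 + C * C).IsSymm := by
    rw [IsSymm, transpose_add, transpose_one, transpose_mul, hCT, neg_mul_neg]
  have hpsd : (1 + C * C).PosSemidef := by
    apply real_psd_of _ 0 hsymm
    simpa [cplx_eq] using hpsdC
  have hunit : IsUnit (1 + C * C) := by
    have h1 : IsUnit (cplx (1 + C * C)) := by rw [hprod]; exact hm.isUnit.mul hp.isUnit
    rw [Matrix.isUnit_iff_isUnit_det, isUnit_iff_ne_zero] at h1 ⊢
    intro h0
    apply h1
    rw [cplx_eq, ← RingHom.map_det, h0, map_zero]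
  have hB2 := msqrt_mul_self _ hpsd
  refine ⟨R, msqrt (1 + C * C), C, hR2, hRs, hRu, msqrt_symm _, isUnit_of_mul_self hB2 hunit,
    hB2, ?_, hRCR, rfl⟩
  have hc : Commute (1 + C * C) C :=
    (Commute.one_left C).add_left ((Commute.refl C).mul_left (Commute.refl C))
  exact hc.cfc_real Real.sqrt

lemma X_facts (V Om : Matrix n n ℝ) (hVpd : V.PosDef) (hT : Omᵀ = -Om) (hO : Om * Om = -1)
    (hC : (cplx V + Complex.I • cplx Om).PosDef) :
    (Xmat V Om)ᵀ = Xmat V Om ∧ IsUnit (Xmat V Om) ∧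
    cplx (Xmat V Om) * (cplx V + Complex.I • cplx Om)⁻¹ * cplx (Xmat V Om)
      = cplx V - Complex.I • cplx Om := by
  obtain ⟨R, B, C, hR2, hRs, hRu, hBs, hBu, hB2, hBC, hRCR, hX⟩ := X_data V Om hVpd hT hO hC
  have hXu : IsUnit (Xmat V Om) := by rw [hX]; exact (hRu.mul hBu).mul hRu
  refine ⟨by rw [hX, transpose_mul, transpose_mul, hRs, hBs, mul_assoc], hXu, ?_⟩
  have hOm : Om = -(R * C * R) := by rw [hRCR, neg_neg]
  set Z := cplx V + Complex.I • cplx Om with hZ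
  set Z' := cplx V - Complex.I • cplx Om with hZ'
  have hZf : Z = cplx R * (1 - Complex.I • cplx C) * cplx R := by
    rw [hZ, ← hR2, hOm, cplx_neg, cplx_mul, cplx_mul, cplx_mul]
    simp only [mul_sub, sub_mul, mul_one, mul_smul_comm, smul_mul_assoc, smul_neg]
    abel
  have hZf' : Z' = cplx R * (1 + Complex.I • cplx C) * cplx R := by
    rw [hZ', ← hR2, hOm, cplx_neg, cplx_mul, cplx_mul, cplx_mul]
    simp only [mul_add, add_mul, mul_one, mul_smul_comm, smul_mul_assoc, smul_neg]
    abel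
  have hXc : cplx (Xmat V Om) = cplx R * cplx B * cplx R := by rw [hX, cplx_mul, cplx_mul]
  have hXcu := cplx_isUnit _ hXu
  have hRcu := cplx_isUnit _ hRu
  have hBcu := cplx_isUnit _ hBu
  have hXd := (Matrix.isUnit_iff_isUnit_det _).1 hXcu
  have hZd := (Matrix.isUnit_iff_isUnit_det _).1 hC.isUnit
  have hRd := (Matrix.isUnit_iff_isUnit_det _).1 hRcu
  have hBd := (Matrix.isUnit_iff_isUnit_det _).1 hBcu
  have hbc : cplx B * cplx C = cplx C * cplx B := by rw [← cplx_mul, hBC, cplx_mul]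
  have hbm : (cplx B)⁻¹ * (1 - Complex.I • cplx C) = (1 - Complex.I • cplx C) * (cplx B)⁻¹ := by
    apply hBcu.mul_left_cancel
    apply hBcu.mul_right_cancel
    rw [← mul_assoc, Matrix.mul_nonsing_inv _ hBd, one_mul, mul_assoc, mul_assoc,
      Matrix.nonsing_inv_mul _ hBd, mul_one]
    simp only [mul_sub, sub_mul, mul_one, one_mul, mul_smul_comm, smul_mul_assoc, hbc]
  have hprod : (1 + Complex.I • cplx C) * (1 - Complex.I • cplx C) = cplx B * cplx B := by
    rw [← cplx_mul, hB2, cplx_add, cplx_one, cplx_mul, mul_sub, add_mul, add_mul]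
    simp only [mul_one, one_mul, mul_smul_comm, smul_mul_assoc, smul_smul, Complex.I_mul_I,
      neg_smul, one_smul]
    abel
  have key : Z' * (cplx (Xmat V Om))⁻¹ * Z = cplx (Xmat V Om) := by
    rw [hXc, Matrix.mul_inv_rev, Matrix.mul_inv_rev, hZf, hZf']
    calc cplx R * (1 + Complex.I • cplx C) * cplx R * ((cplx R)⁻¹ * ((cplx B)⁻¹ * (cplx R)⁻¹)) *
          (cplx R * (1 - Complex.I • cplx C) * cplx R)
        = cplx R * (1 + Complex.I • cplx C) * (cplx R * (cplx R)⁻¹) * (cplx B)⁻¹ *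
          ((cplx R)⁻¹ * cplx R) * (1 - Complex.I • cplx C) * cplx R := by
          simp only [mul_assoc]
      _ = cplx R * ((1 + Complex.I • cplx C) * ((cplx B)⁻¹ * (1 - Complex.I • cplx C)))
          * cplx R := by
          rw [Matrix.mul_nonsing_inv _ hRd, Matrix.nonsing_inv_mul _ hRd]
          simp only [mul_assoc, one_mul]
      _ = _ := by
          rw [hbm, ← mul_assoc (1 + Complex.I • cplx C), hprod, mul_assoc (cplx B),
            Matrix.mul_nonsing_inv _ hBd, mul_one]
  calc cplx (Xmat V Om) * Z⁻¹ * cplx (Xmat V Om)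
      = (Z' * (cplx (Xmat V Om))⁻¹ * Z) * Z⁻¹ * cplx (Xmat V Om) := by rw [key]
    _ = Z' := by
      rw [Matrix.mul_nonsing_inv_cancel_right _ _ hZd, Matrix.nonsing_inv_mul_cancel_right _ _ hXd]

/-- If `V - P > 0` and `P` is bona fide, then `P` is in the image. -/
lemma image_of_lt (V Om P : Matrix n n ℝ) (hVs : V.IsSymm) (hVpd : V.PosDef) (hT : Omᵀ = -Om)
    (hO : Om * Om = -1) (hC : (cplx V + Complex.I • cplx Om).PosDef)
    (hP : BonaFide P Om) (hVP : (V - P).PosDef) :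
    ∃ W : Matrix n n ℝ, W.IsSymm ∧ BonaFide W Om ∧
      P = V - Xmat V Om * (V + W)⁻¹ * Xmat V Om := by
  obtain ⟨hXs, hXu, hXZ⟩ := X_facts V Om hVpd hT hO hC
  set X := Xmat V Om with hX
  have hXd := (Matrix.isUnit_iff_isUnit_det _).1 hXu
  have hDs : (V - P)ᵀ = V - P := by
    have := hVP.1.eq
    rwa [conjTranspose_eq_transpose_of_trivial] at this
  refine ⟨X * (V - P)⁻¹ * X - V, ?_, ?_, ?_⟩
  · rw [IsSymm, transpose_sub, transpose_mul, transpose_mul, hXs, transpose_nonsing_inv, hDs,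
      hVs.eq, mul_assoc]
  · have h1 := inv_anti hC (cplx_pd _ hVP) (by
      have : cplx V + Complex.I • cplx Om - cplx (V - P) = cplx P + Complex.I • cplx Om := by
        rw [cplx_sub]; abel
      rw [this]; exact hP)
    have h2 := h1.mul_mul_conjTranspose_same (cplx X)
    rw [cplx_conjTranspose, hXs, mul_sub, sub_mul, hXZ] at h2
    unfold BonaFide
    convert h2 using 1
    rw [cplx_sub, cplx_mul, cplx_mul, cplx_inv _ hVP.isUnit]
    abel
  · have hDd := (Matrix.isUnit_iff_isUnit_det _).1 hVP.isUnit
    have hDi : IsUnit (V - P) := hVP.isUnit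
    rw [add_sub_cancel, Matrix.mul_inv_rev, Matrix.mul_inv_rev,
      Matrix.nonsing_inv_nonsing_inv _ hDd, ← mul_assoc, Matrix.mul_nonsing_inv _ hXd, one_mul,
      Matrix.nonsing_inv_mul_cancel_right _ _ hXd, sub_sub_cancel]

/-- A bona fide matrix strictly below `V`. -/
lemma exists_lt (V Om : Matrix n n ℝ) (hVs : V.IsSymm) (hVpd : V.PosDef) (hT : Omᵀ = -Om)
    (hO : Om * Om = -1) (hC : (cplx V + Complex.I • cplx Om).PosDef) :
    ∃ P : Matrix n n ℝ, BonaFide P Om ∧ (V - P).PosDef := by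
  obtain ⟨hXs, hXu, hXZ⟩ := X_facts V Om hVpd hT hO hC
  set X := Xmat V Om with hX
  have h2V : (V + V).PosDef := hVpd.add hVpd
  have hZt : (cplx V + Complex.I • cplx Om)ᵀ = cplx V - Complex.I • cplx Om := by
    rw [transpose_add, transpose_smul, ← cplx_transpose, ← cplx_transpose, hT, hVs.eq, cplx_neg,
      smul_neg, sub_eq_add_neg]
  have hC' := hC.transpose
  have h1 := (inv_anti (cplx_pd _ h2V) hC (by
      have : cplx (V + V) - (cplx V + Complex.I • cplx Om) = cplx V - Complex.I • cplx Om := by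
        rw [cplx_add]; abel
      rw [this, ← hZt]; exact hC'.posSemidef)).mul_mul_conjTranspose_same (cplx X)
  rw [cplx_conjTranspose, hXs, mul_sub, sub_mul, hXZ] at h1
  have hYs : (X * (V + V)⁻¹ * X)ᵀ = X * (V + V)⁻¹ * X := by
    rw [transpose_mul, transpose_mul, hXs, transpose_nonsing_inv, transpose_add, hVs.eq, mul_assoc]
  refine ⟨V - X * (V + V)⁻¹ * X, ?_, ?_⟩
  · have h3 := h1.transpose
    rw [← cplx_inv _ h2V.isUnit, ← cplx_mul, ← cplx_mul, transpose_sub, ← hZt, transpose_transpose,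
      ← cplx_transpose, hYs] at h3
    have e : cplx (V - X * (V + V)⁻¹ * X) + Complex.I • cplx Om
        = cplx V + Complex.I • cplx Om - cplx (X * (V + V)⁻¹ * X) := by
      rw [cplx_sub]; abel
    unfold BonaFide
    rw [e]
    exact h3
  · rw [sub_sub_cancel]
    have := (Matrix.IsUnit.posDef_star_right_conjugate_iff hXu).2 h2V.inv
    rwa [star_eq_conjTranspose, conjTranspose_eq_transpose_of_trivial, hXs] at this

lemma bonaFide_SST (Om S : Matrix n n ℝ) (hT : Omᵀ = -Om) (hO : Om * Om = -1)
    (hS : S * Om * Sᵀ = Om) : BonaFide (S * Sᵀ) Om := by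
  have hH : (1 + Complex.I • cplx Om)ᴴ = 1 + Complex.I • cplx Om := by
    rw [conjTranspose_add, conjTranspose_one, conjTranspose_smul, cplx_conjTranspose, hT, cplx_neg]
    simp
  have h0 : (1 + Complex.I • cplx Om).PosSemidef := by
    have h1 := (posSemidef_conjTranspose_mul_self (1 + Complex.I • cplx Om)).smul
      (a := (2⁻¹ : ℝ)) (by norm_num)
    convert h1 using 1
    rw [hH, eq_inv_smul_iff₀ (by norm_num), two_smul, mul_add, add_mul, add_mul]
    simp only [mul_one, one_mul, mul_smul_comm, smul_mul_assoc, smul_smul, Complex.I_mul_I,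
      neg_smul, one_smul, ← cplx_mul, hO, cplx_neg, cplx_one, neg_neg]
    abel
  have h2 := h0.mul_mul_conjTranspose_same (cplx S)
  unfold BonaFide
  convert h2 using 1
  rw [cplx_conjTranspose, mul_add, add_mul, mul_one, mul_smul_comm, smul_mul_assoc, ← cplx_mul,
    ← cplx_mul, ← cplx_mul, hS]

lemma isClosed_psd : IsClosed {M : Matrix n n ℝ | M.PosSemidef} := by
  have : {M : Matrix n n ℝ | M.PosSemidef}
      = {M | Mᴴ = M} ∩ ⋂ x : n → ℝ, {M | 0 ≤ star x ⬝ᵥ (M *ᵥ x)} := by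
    ext M
    simp only [posSemidef_iff_dotProduct_mulVec, Set.mem_ofPred_eq, Set.mem_inter_iff,
      Set.mem_iInter, IsHermitian]
  rw [this]
  refine (isClosed_eq (by fun_prop) continuous_id).inter (isClosed_iInter fun x => ?_)
  exact isClosed_le continuous_const (by fun_prop)

end main
/-- for a symplectic `S`, `SSᵀ` lies in the closure of the image of the map
`f_σ : W ↦ V_σ − X_{V_σ}(V_σ+W)⁻¹X_{V_σ}` (over bona fide quantum covariance matrices `W`)
if and only if `V_σ − SSᵀ` is positive semidefinite. -/
theorem mem_closure_image_fsigma_iff (N : ℕ) (hN : 1 ≤ N)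
    (Vσ : Matrix (Fin (2*N)) (Fin (2*N)) ℝ)
    (hVσsymm : Vσ.IsSymm) (hVσpd : Vσ.PosDef)
    (hVσpdC : (cplx Vσ + Complex.I • cplx (symp N)).PosDef)
    (S : Matrix (Fin (2*N)) (Fin (2*N)) ℝ)
    (hS : S * symp N * Sᵀ = symp N) :
    S * Sᵀ ∈ closure {M : Matrix (Fin (2*N)) (Fin (2*N)) ℝ |
        ∃ W : Matrix (Fin (2*N)) (Fin (2*N)) ℝ, W.IsSymm ∧ BonaFide W (symp N) ∧
          M = Vσ - Xmat Vσ (symp N) * (Vσ + W)⁻¹ * Xmat Vσ (symp N)}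
      ↔ (Vσ - S * Sᵀ).PosSemidef := by
  have hT := symp_transpose N
  have hO := symp_mul_symp N
  constructor
  · intro h
    have hcl : IsClosed {M : Matrix (Fin (2*N)) (Fin (2*N)) ℝ | (Vσ - M).PosSemidef} :=
      isClosed_psd.preimage (continuous_const.sub continuous_id)
    refine closure_minimal ?_ hcl h
    rintro M ⟨W, hWs, hWb, rfl⟩
    obtain ⟨hXs, -, -⟩ := X_facts Vσ (symp N) hVσpd hT hO hVσpdC
    have hW := real_psd_of W (symp N) hWs hWb
    have h1 := (hVσpd.posSemidef.add hW).inv.mul_mul_conjTranspose_same (Xmat Vσ (symp N))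
    rw [conjTranspose_eq_transpose_of_trivial, hXs] at h1
    rw [Set.mem_ofPred_eq, sub_sub_cancel]
    exact h1
  · intro h
    obtain ⟨P0, hP0, hVP0⟩ := exists_lt Vσ (symp N) hVσsymm hVσpd hT hO hVσpdC
    have hSb := bonaFide_SST (symp N) S hT hO hS
    have hcont : Continuous fun t : ℝ => (1 - t) • (S * Sᵀ) + t • P0 := by fun_prop
    have hlim : Filter.Tendsto (fun t : ℝ => (1 - t) • (S * Sᵀ) + t • P0)
        (nhdsWithin 0 (Set.Ioi 0)) (nhds (S * Sᵀ)) := by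
      have := (hcont.tendsto 0).mono_left (nhdsWithin_le_nhds (s := Set.Ioi 0))
      simpa using this
    refine mem_closure_of_tendsto hlim ?_
    filter_upwards [Ioo_mem_nhdsGT (zero_lt_one' ℝ)] with t ht
    have ht0 : 0 < t := ht.1
    have ht1 : 0 ≤ 1 - t := by linarith [ht.2]
    apply image_of_lt Vσ (symp N) _ hVσsymm hVσpd hT hO hVσpdC
    · have h1 := (hSb.smul (a := (1 - t : ℝ)) ht1).add (hP0.smul (a := t) ht0.le)
      unfold BonaFide
      convert h1 using 1
      rw [cplx_add, cplx_smul, cplx_smul]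
      ext i j
      simp
      ring
    · have h1 := (hVP0.smul (a := t) ht0).posSemidef_add (h.smul (a := (1 - t : ℝ)) ht1)
      convert h1 using 1
      ext i j
      simp
      ring
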